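/- Let d ≥ 2, r₀ > 0, and let p be an exponent with d/2 < p < ∞. Let u be a real-valued essentially bounded measurable function on B(0,r₀) and let f be a real-valued function on B(0,r₀) with ∫_{B(0,r₀)} |f|^p dx < ∞. Assume that for every smooth compactly supported function φ : ℝ^d → ℝ whose support is contained in B(0,r₀) \ {0}, one has ∫_{B(0,r₀)} u Δφ dx = ∫_{B(0,r₀)} f φ dx. Then the same identity ∫_{B(0,r₀)} u Δφ dx = ∫_{B(0,r₀)} f φ dx holds for every smooth compactly supported φ : ℝ^d → ℝ whose support is contained in B(0,r₀). -/

import Mathlib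

open MeasureTheory

/-- The Laplacian `Δφ(x) = Σᵢ ∂²φ/∂xᵢ²(x)` of a function on `ℝ^d`, computed via iterated
Fréchet derivatives in the coordinate directions. -/
noncomputable def lap (d : ℕ) (φ : EuclideanSpace ℝ (Fin d) → ℝ)
    (x : EuclideanSpace ℝ (Fin d)) : ℝ :=
  ∑ i : Fin d,
    fderiv ℝ (fun y => fderiv ℝ φ y (EuclideanSpace.single i 1)) x (EuclideanSpace.single i 1)

open Filter Topology
open scoped ContDiff

section

variable {d : ℕ}

/-- The partial derivative in the `i`-th coordinate direction. -/
noncomputable def partialD (i : Fin d) (φ : EuclideanSpace ℝ (Fin d) → ℝ)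
    (x : EuclideanSpace ℝ (Fin d)) : ℝ :=
  fderiv ℝ φ x (EuclideanSpace.single i 1)

theorem lap_eq_sum_partialD (φ : EuclideanSpace ℝ (Fin d) → ℝ) (x : EuclideanSpace ℝ (Fin d)) :
    lap d φ x = ∑ i, partialD i (partialD i φ) x := rfl

theorem ContDiff.partialD {φ : EuclideanSpace ℝ (Fin d) → ℝ} (hφ : ContDiff ℝ ∞ φ) (i : Fin d) :
    ContDiff ℝ ∞ (partialD i φ) :=
  (hφ.fderiv_right (m := ∞) (by simp)).clm_apply contDiff_const

theorem ContDiff.differentiable_infty {φ : EuclideanSpace ℝ (Fin d) → ℝ} (hφ : ContDiff ℝ ∞ φ) :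
    Differentiable ℝ φ :=
  hφ.differentiable (by simp)

theorem ContDiff.continuous_lap {φ : EuclideanSpace ℝ (Fin d) → ℝ} (hφ : ContDiff ℝ ∞ φ) :
    Continuous (lap d φ) :=
  continuous_finsetSum _ fun i _ => ((hφ.partialD i).partialD i).continuous

theorem tsupport_partialD_subset (i : Fin d) (φ : EuclideanSpace ℝ (Fin d) → ℝ) :
    tsupport (partialD i φ) ⊆ tsupport φ :=
  tsupport_fderiv_apply_subset ℝ _

theorem HasCompactSupport.partialD {φ : EuclideanSpace ℝ (Fin d) → ℝ} (hφ : HasCompactSupport φ)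
    (i : Fin d) : HasCompactSupport (partialD i φ) :=
  hφ.fderiv_apply ℝ _

theorem lap_eq_zero_of_notMem_tsupport {φ : EuclideanSpace ℝ (Fin d) → ℝ}
    {x : EuclideanSpace ℝ (Fin d)} (hx : x ∉ tsupport φ) : lap d φ x = 0 := by
  rw [lap_eq_sum_partialD]
  refine Finset.sum_eq_zero fun i _ => image_eq_zero_of_notMem_tsupport fun h => hx ?_
  exact tsupport_partialD_subset i φ (tsupport_partialD_subset i _ h)

theorem HasCompactSupport.lap {φ : EuclideanSpace ℝ (Fin d) → ℝ} (hφ : HasCompactSupport φ) :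
    HasCompactSupport (lap d φ) :=
  HasCompactSupport.intro hφ fun _ hx => lap_eq_zero_of_notMem_tsupport hx

theorem partialD_mul (i : Fin d) {φ χ : EuclideanSpace ℝ (Fin d) → ℝ}
    (hφ : Differentiable ℝ φ) (hχ : Differentiable ℝ χ) :
    partialD i (fun x => φ x * χ x) = fun x => φ x * partialD i χ x + χ x * partialD i φ x := by
  ext x
  simp [partialD, fderiv_fun_mul (hφ x) (hχ x)]

theorem partialD_add (i : Fin d) {φ χ : EuclideanSpace ℝ (Fin d) → ℝ}
    (hφ : Differentiable ℝ φ) (hχ : Differentiable ℝ χ) :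
    partialD i (fun x => φ x + χ x) = fun x => partialD i φ x + partialD i χ x := by
  ext x
  simp [partialD, fderiv_fun_add (hφ x) (hχ x)]

theorem partialD_const_mul (i : Fin d) {φ : EuclideanSpace ℝ (Fin d) → ℝ} (c : ℝ)
    (hφ : Differentiable ℝ φ) :
    partialD i (fun x => c * φ x) = fun x => c * partialD i φ x := by
  ext x
  simp [partialD, fderiv_const_mul (hφ x)]

theorem partialD_comp_smul (i : Fin d) (φ : EuclideanSpace ℝ (Fin d) → ℝ) (c : ℝ) :
    partialD i (fun x => φ (c • x)) = fun x => c * partialD i φ (c • x) := by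
  ext x
  simp [partialD, fderiv_comp_smul]

theorem lap_mul {φ χ : EuclideanSpace ℝ (Fin d) → ℝ} (hφ : ContDiff ℝ ∞ φ) (hχ : ContDiff ℝ ∞ χ)
    (x : EuclideanSpace ℝ (Fin d)) :
    lap d (fun x => φ x * χ x) x =
      φ x * lap d χ x + 2 * ∑ i, partialD i φ x * partialD i χ x + χ x * lap d φ x := by
  simp only [lap_eq_sum_partialD, Finset.mul_sum, ← Finset.sum_add_distrib]
  refine Finset.sum_congr rfl fun i _ => ?_
  have hφ' := (hφ.partialD i).differentiable_infty
  have hχ' := (hχ.partialD i).differentiable_infty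
  have hφ₀ := hφ.differentiable_infty
  have hχ₀ := hχ.differentiable_infty
  rw [partialD_mul i hφ₀ hχ₀, partialD_add i (hφ₀.fun_mul hχ') (hχ₀.fun_mul hφ'),
    partialD_mul i hφ₀ hχ', partialD_mul i hχ₀ hφ']
  ring

theorem lap_add {φ χ : EuclideanSpace ℝ (Fin d) → ℝ} (hφ : ContDiff ℝ ∞ φ) (hχ : ContDiff ℝ ∞ χ)
    (x : EuclideanSpace ℝ (Fin d)) :
    lap d (fun x => φ x + χ x) x = lap d φ x + lap d χ x := by
  simp only [lap_eq_sum_partialD, ← Finset.sum_add_distrib]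
  refine Finset.sum_congr rfl fun i _ => ?_
  rw [partialD_add i hφ.differentiable_infty hχ.differentiable_infty,
    partialD_add i (hφ.partialD i).differentiable_infty (hχ.partialD i).differentiable_infty]

theorem lap_const_mul {φ : EuclideanSpace ℝ (Fin d) → ℝ} (hφ : ContDiff ℝ ∞ φ) (c : ℝ)
    (x : EuclideanSpace ℝ (Fin d)) : lap d (fun x => c * φ x) x = c * lap d φ x := by
  simp only [lap_eq_sum_partialD, Finset.mul_sum]
  refine Finset.sum_congr rfl fun i _ => ?_
  rw [partialD_const_mul i c hφ.differentiable_infty,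
    partialD_const_mul i c (hφ.partialD i).differentiable_infty]

theorem lap_comp_smul {φ : EuclideanSpace ℝ (Fin d) → ℝ} (hφ : ContDiff ℝ ∞ φ) (c : ℝ)
    (x : EuclideanSpace ℝ (Fin d)) : lap d (fun x => φ (c • x)) x = c ^ 2 * lap d φ (c • x) := by
  simp only [lap_eq_sum_partialD, Finset.mul_sum]
  refine Finset.sum_congr rfl fun i _ => ?_
  rw [partialD_comp_smul, partialD_const_mul i c, partialD_comp_smul]
  · ring
  · exact (hφ.partialD i).differentiable_infty.comp (differentiable_id.const_smul c)

theorem integral_mul_lap_comm {φ χ : EuclideanSpace ℝ (Fin d) → ℝ} (hφ : ContDiff ℝ ∞ φ)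
    (hφc : HasCompactSupport φ) (hχ : ContDiff ℝ ∞ χ) :
    ∫ x, φ x * lap d χ x = ∫ x, lap d φ x * χ x := by
  have hint : ∀ {a b : EuclideanSpace ℝ (Fin d) → ℝ}, ContDiff ℝ ∞ a → HasCompactSupport a →
      ContDiff ℝ ∞ b → Integrable fun x => a x * b x := fun ha hac hb =>
    (ha.continuous.mul hb.continuous).integrable_of_hasCompactSupport hac.mul_right
  have parts : ∀ {a b : EuclideanSpace ℝ (Fin d) → ℝ} (i : Fin d), ContDiff ℝ ∞ a →
      HasCompactSupport a → ContDiff ℝ ∞ b →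
      ∫ x, a x * partialD i b x = - ∫ x, partialD i a x * b x := fun i ha hac hb =>
    integral_mul_fderiv_eq_neg_fderiv_mul_of_integrable
      (hint (ha.partialD i) (hac.partialD i) hb) (hint ha hac (hb.partialD i)) (hint ha hac hb)
      (fun x _ => ha.differentiable_infty x) fun x _ => hb.differentiable_infty x
  simp only [lap_eq_sum_partialD, Finset.mul_sum, Finset.sum_mul]
  rw [integral_finsetSum _ fun i _ => hint hφ hφc ((hχ.partialD i).partialD i),
    integral_finsetSum _ fun i _ =>
      hint ((hφ.partialD i).partialD i) ((hφc.partialD i).partialD i) hχ]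
  refine Finset.sum_congr rfl fun i _ => ?_
  rw [parts i hφ hφc (hχ.partialD i), parts i (hφ.partialD i) (hφc.partialD i) hχ, neg_neg]

/-- The regularized logarithm `n⁻¹ log (|x|² + e⁻ⁿ)`. -/
noncomputable def regLog (d n : ℕ) (x : EuclideanSpace ℝ (Fin d)) : ℝ :=
  (n : ℝ)⁻¹ * Real.log (‖x‖ ^ 2 + Real.exp (-n))

theorem norm_sq_add_exp_pos (n : ℕ) (x : EuclideanSpace ℝ (Fin d)) :
    0 < ‖x‖ ^ 2 + Real.exp (-n) := by positivity

theorem contDiff_regLog (d n : ℕ) : ContDiff ℝ ∞ (regLog d n) :=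
  contDiff_const.mul <| ((contDiff_norm_sq ℝ).add contDiff_const).log fun x =>
    (norm_sq_add_exp_pos n x).ne'

theorem regLog_zero {n : ℕ} (hn : n ≠ 0) : regLog d n 0 = -1 := by
  have : (n : ℝ) ≠ 0 := by exact_mod_cast hn
  simp [regLog, this]

theorem abs_regLog_le {n : ℕ} (hn : n ≠ 0) {r : ℝ} {x : EuclideanSpace ℝ (Fin d)}
    (hx : ‖x‖ ≤ r) : |regLog d n x| ≤ 1 + r ^ 2 := by
  have hn1 : (1 : ℝ) ≤ n := by exact_mod_cast Nat.one_le_iff_ne_zero.2 hn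
  have hn0 : (0 : ℝ) < n := by linarith
  have hlow : -(n : ℝ) ≤ Real.log (‖x‖ ^ 2 + Real.exp (-n)) := by
    rw [Real.le_log_iff_exp_le (norm_sq_add_exp_pos n x)]
    nlinarith [sq_nonneg ‖x‖]
  have hup : Real.log (‖x‖ ^ 2 + Real.exp (-n)) ≤ r ^ 2 := by
    have h1 := Real.log_le_sub_one_of_pos (norm_sq_add_exp_pos n x)
    have h2 : Real.exp (-n) ≤ 1 := Real.exp_le_one_iff.2 (by linarith)
    have h3 : ‖x‖ ^ 2 ≤ r ^ 2 := by gcongr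
    linarith
  rw [regLog, inv_mul_eq_div, abs_le, le_div_iff₀ hn0, div_le_iff₀ hn0]
  constructor <;> nlinarith [sq_nonneg r]

theorem tendsto_regLog {x : EuclideanSpace ℝ (Fin d)} (hx : x ≠ 0) :
    Tendsto (fun n : ℕ => regLog d n x) atTop (𝓝 0) := by
  have hexp : Tendsto (fun n : ℕ => ‖x‖ ^ 2 + Real.exp (-n)) atTop (𝓝 (‖x‖ ^ 2 + 0)) :=
    (Real.tendsto_exp_neg_atTop_nhds_zero.comp tendsto_natCast_atTop_atTop).const_add _
  have hlog := hexp.log (by simpa using hx)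
  simpa [regLog] using (tendsto_inv_atTop_zero.comp tendsto_natCast_atTop_atTop).mul hlog

theorem hasFDerivAt_norm_sq_add (δ : ℝ) (x : EuclideanSpace ℝ (Fin d)) :
    HasFDerivAt (fun y : EuclideanSpace ℝ (Fin d) => ‖y‖ ^ 2 + δ) (2 • innerSL ℝ x) x :=
  (hasStrictFDerivAt_norm_sq x).hasFDerivAt.add_const δ

theorem partialD_regLog (n : ℕ) (i : Fin d) :
    partialD i (regLog d n) =
      fun x => (n : ℝ)⁻¹ * (2 * x i / (‖x‖ ^ 2 + Real.exp (-n))) := by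
  ext x
  have h := ((hasFDerivAt_norm_sq_add (Real.exp (-n)) x).log
    (norm_sq_add_exp_pos n x).ne').const_mul ((n : ℝ)⁻¹)
  change fderiv ℝ (fun y => (n : ℝ)⁻¹ * Real.log (‖y‖ ^ 2 + Real.exp (-n))) x _ = _
  rw [h.fderiv]
  simp only [smul_apply, innerSL_apply_apply,
    EuclideanSpace.inner_single_right, smul_eq_mul, nsmul_eq_mul, Nat.cast_ofNat, one_mul,
    conj_trivial]
  ring

theorem norm_mul_abs_partialD_regLog_le (n : ℕ) (i : Fin d) (x : EuclideanSpace ℝ (Fin d)) :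
    ‖x‖ * |partialD i (regLog d n) x| ≤ 2 * (n : ℝ)⁻¹ := by
  have hq := norm_sq_add_exp_pos n x
  have hxi : |x i| ≤ ‖x‖ := PiLp.norm_apply_le x i
  have key : ‖x‖ * (2 * |x i| / (‖x‖ ^ 2 + Real.exp (-n))) ≤ 2 := by
    rw [← mul_div_assoc, div_le_iff₀ hq]
    nlinarith [norm_nonneg x, Real.exp_pos (-n : ℝ)]
  rw [partialD_regLog]
  simp only [abs_mul, abs_div, abs_of_pos hq, abs_two, abs_inv, Nat.abs_cast]
  calc _ = (n : ℝ)⁻¹ * (‖x‖ * (2 * |x i| / (‖x‖ ^ 2 + Real.exp (-n)))) := by ring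
    _ ≤ (n : ℝ)⁻¹ * 2 := by gcongr
    _ = _ := by ring

theorem lap_regLog_nonneg (hd : 2 ≤ d) (n : ℕ) (x : EuclideanSpace ℝ (Fin d)) :
    0 ≤ lap d (regLog d n) x := by
  have hq := norm_sq_add_exp_pos n x
  have hi : ∀ i, partialD i (partialD i (regLog d n)) x = (n : ℝ)⁻¹ *
      (2 / (‖x‖ ^ 2 + Real.exp (-n)) - 4 * (x i) ^ 2 / (‖x‖ ^ 2 + Real.exp (-n)) ^ 2) := by
    intro i
    have hc : HasFDerivAt (fun y : EuclideanSpace ℝ (Fin d) => y i)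
        (EuclideanSpace.proj i : EuclideanSpace ℝ (Fin d) →L[ℝ] ℝ) x :=
      (EuclideanSpace.proj i : EuclideanSpace ℝ (Fin d) →L[ℝ] ℝ).hasFDerivAt
    have hinv : HasFDerivAt (fun y : EuclideanSpace ℝ (Fin d) => (‖y‖ ^ 2 + Real.exp (-n))⁻¹) _ x :=
      (hasDerivAt_inv hq.ne').comp_hasFDerivAt x (hasFDerivAt_norm_sq_add (Real.exp (-n)) x)
    have h := ((hc.const_mul 2).fun_mul hinv).const_mul ((n : ℝ)⁻¹)
    rw [partialD_regLog]
    simp only [div_eq_mul_inv]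
    rw [partialD, h.fderiv]
    simp only [smul_apply, add_apply, innerSL_apply_apply, EuclideanSpace.inner_single_right,
      smul_eq_mul, nsmul_eq_mul, Nat.cast_ofNat, one_mul, conj_trivial, PiLp.proj_apply,
      PiLp.single_apply, if_true]
    field_simp
    ring
  rw [lap_eq_sum_partialD, Finset.sum_congr rfl fun i _ => hi i, ← Finset.mul_sum,
    Finset.sum_sub_distrib, ← Finset.sum_div, ← Finset.sum_div, ← Finset.mul_sum,
    ← EuclideanSpace.real_norm_sq_eq]
  refine mul_nonneg (by positivity) ?_
  have hd' : (2 : ℝ) ≤ d := by exact_mod_cast hd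
  rw [Finset.sum_const, Finset.card_univ, Fintype.card_fin, nsmul_eq_mul, sub_nonneg,
    div_le_iff₀ (by positivity)]
  have : (d : ℝ) * 2 / (‖x‖ ^ 2 + Real.exp (-n)) * (‖x‖ ^ 2 + Real.exp (-n)) ^ 2
      = 2 * d * (‖x‖ ^ 2 + Real.exp (-n)) := by field_simp
  rw [this]
  nlinarith [sq_nonneg ‖x‖, Real.exp_pos (-n : ℝ)]

theorem exists_bound_partialD {φ : EuclideanSpace ℝ (Fin d) → ℝ}
    (hφ : ContDiff ℝ ∞ φ) (hφc : HasCompactSupport φ) :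
    ∃ C, 0 ≤ C ∧ ∀ i x, |partialD i φ x| ≤ C := by
  obtain ⟨C, hC⟩ := (hφc.fderiv ℝ).exists_bound_of_continuous (hφ.continuous_fderiv (by simp))
  refine ⟨C, (norm_nonneg _).trans (hC 0), fun i x => ?_⟩
  calc |partialD i φ x| ≤ ‖fderiv ℝ φ x‖ * ‖EuclideanSpace.single i (1 : ℝ)‖ :=
        (fderiv ℝ φ x).le_opNorm _
    _ ≤ C := by simpa using hC x

theorem exists_abs_le_mul_norm {φ : EuclideanSpace ℝ (Fin d) → ℝ}
    (hφ : ContDiff ℝ ∞ φ) (hφc : HasCompactSupport φ) (h0 : φ 0 = 0) :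
    ∃ K, 0 ≤ K ∧ ∀ x, |φ x| ≤ K * ‖x‖ := by
  obtain ⟨K, hK⟩ := ContDiff.lipschitzWith_of_hasCompactSupport hφc hφ (by simp)
  exact ⟨K, K.2, fun x => by simpa [h0] using hK.norm_sub_le x 0⟩

/-- The defect `∫ u Δφ - ∫ f φ` over the ball of radius `r` in the weak form of `Δu = f`. -/
noncomputable def weakDefect (u f : EuclideanSpace ℝ (Fin d) → ℝ) (r : ℝ)
    (φ : EuclideanSpace ℝ (Fin d) → ℝ) : ℝ :=
  (∫ x in Metric.ball (0 : EuclideanSpace ℝ (Fin d)) r, u x * lap d φ x) -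
    ∫ x in Metric.ball (0 : EuclideanSpace ℝ (Fin d)) r, f x * φ x

section weakDefect

variable {u f : EuclideanSpace ℝ (Fin d) → ℝ} {r : ℝ}

theorem integrableOn_mul_lap
    (hu : MemLp u ⊤ (volume.restrict (Metric.ball (0 : EuclideanSpace ℝ (Fin d)) r)))
    {φ : EuclideanSpace ℝ (Fin d) → ℝ} (hφ : ContDiff ℝ ∞ φ) (hφc : HasCompactSupport φ) :
    IntegrableOn (fun x => u x * lap d φ x) (Metric.ball 0 r) :=
  ((hφ.continuous_lap.integrable_of_hasCompactSupport hφc.lap).restrict).mul_of_top_right hu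

theorem integrableOn_mul_test (hf : IntegrableOn f (Metric.ball 0 r))
    {φ : EuclideanSpace ℝ (Fin d) → ℝ} (hφ : ContDiff ℝ ∞ φ) (hφc : HasCompactSupport φ) :
    IntegrableOn (fun x => f x * φ x) (Metric.ball 0 r) := by
  obtain ⟨C, hC⟩ := hφc.exists_bound_of_continuous hφ.continuous
  exact Integrable.mul_bdd (c := C) hf hφ.continuous.aestronglyMeasurable (.of_forall hC)

theorem weakDefect_add
    (hu : MemLp u ⊤ (volume.restrict (Metric.ball (0 : EuclideanSpace ℝ (Fin d)) r)))
    (hf : IntegrableOn f (Metric.ball 0 r)) {φ χ : EuclideanSpace ℝ (Fin d) → ℝ}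
    (hφ : ContDiff ℝ ∞ φ) (hφc : HasCompactSupport φ)
    (hχ : ContDiff ℝ ∞ χ) (hχc : HasCompactSupport χ) :
    weakDefect u f r (fun x => φ x + χ x) = weakDefect u f r φ + weakDefect u f r χ := by
  simp only [weakDefect, lap_add hφ hχ, mul_add]
  rw [integral_add (integrableOn_mul_lap hu hφ hφc) (integrableOn_mul_lap hu hχ hχc),
    integral_add (integrableOn_mul_test hf hφ hφc) (integrableOn_mul_test hf hχ hχc)]
  ring

theorem weakDefect_const_mul {φ : EuclideanSpace ℝ (Fin d) → ℝ} (hφ : ContDiff ℝ ∞ φ) (c : ℝ) :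
    weakDefect u f r (fun x => c * φ x) = c * weakDefect u f r φ := by
  simp only [weakDefect, lap_const_mul hφ, mul_left_comm _ c, integral_const_mul, mul_sub]

/-- If the multipliers are uniformly bounded and tend to zero away from the origin, then their
integrals against an integrable function tend to zero. -/
theorem tendsto_integral_mul_of_tendsto_zero {g : EuclideanSpace ℝ (Fin d) → ℝ} (hd : 2 ≤ d)
    (hg : IntegrableOn g (Metric.ball 0 r)) {w : ℕ → EuclideanSpace ℝ (Fin d) → ℝ}
    (hw : ∀ n, Continuous (w n)) {C : ℝ}
    (hC : ∀ᶠ n in atTop, ∀ x ∈ Metric.ball (0 : EuclideanSpace ℝ (Fin d)) r, |w n x| ≤ C)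
    (hlim : ∀ x ≠ 0, Tendsto (fun n => w n x) atTop (𝓝 0)) :
    Tendsto (fun n => ∫ x in Metric.ball (0 : EuclideanSpace ℝ (Fin d)) r, g x * w n x)
      atTop (𝓝 0) := by
  have : NeZero d := ⟨by omega⟩
  rw [← integral_zero (EuclideanSpace ℝ (Fin d)) ℝ
    (μ := volume.restrict (Metric.ball (0 : EuclideanSpace ℝ (Fin d)) r))]
  refine tendsto_integral_filter_of_dominated_convergence (fun x => |g x| * C) ?_ ?_ ?_ ?_
  · exact .of_forall fun n => hg.aestronglyMeasurable.mul (hw n).aestronglyMeasurable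
  · filter_upwards [hC] with n hn
    filter_upwards [ae_restrict_mem measurableSet_ball] with x hx
    rw [Real.norm_eq_abs, abs_mul]
    gcongr
    exact hn x hx
  · exact hg.abs.mul_const C
  · filter_upwards [ae_restrict_of_ae (Measure.ae_ne volume (0 : EuclideanSpace ℝ (Fin d)))]
      with x hx
    simpa using (hlim x hx).const_mul (g x)

theorem exists_ae_abs_le {μ : Measure (EuclideanSpace ℝ (Fin d))} (hu : MemLp u ⊤ μ) :
    ∃ M, 0 ≤ M ∧ ∀ᵐ x ∂μ, |u x| ≤ M := by
  refine ⟨(eLpNorm u ⊤ μ).toReal, ENNReal.toReal_nonneg, ?_⟩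
  filter_upwards [ae_le_eLpNormEssSup (f := u) (μ := μ)] with x hx
  rw [← eLpNorm_exponent_top] at hx
  simpa using ENNReal.toReal_mono hu.2.ne hx

/-- A test function vanishing at the origin has zero defect if all test functions supported away
from the origin do. -/
theorem weakDefect_eq_zero_of_apply_zero (hd : 2 ≤ d)
    (hu : MemLp u ⊤ (volume.restrict (Metric.ball (0 : EuclideanSpace ℝ (Fin d)) r)))
    (hf : IntegrableOn f (Metric.ball 0 r))
    (hweak : ∀ φ : EuclideanSpace ℝ (Fin d) → ℝ, ContDiff ℝ ∞ φ → HasCompactSupport φ →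
      tsupport φ ⊆ Metric.ball 0 r \ {0} → weakDefect u f r φ = 0)
    {φ : EuclideanSpace ℝ (Fin d) → ℝ} (hφ : ContDiff ℝ ∞ φ) (hφc : HasCompactSupport φ)
    (hφs : tsupport φ ⊆ Metric.ball 0 r) (h0 : φ 0 = 0) : weakDefect u f r φ = 0 := by
  let η : ContDiffBump (0 : EuclideanSpace ℝ (Fin d)) := ⟨1, 2, one_pos, one_lt_two⟩
  have hη : ContDiff ℝ ∞ η := η.contDiff
  have hηc : HasCompactSupport η := η.hasCompactSupport
  have hηs : tsupport η = Metric.closedBall 0 2 := η.tsupport_eq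
  let w : ℕ → EuclideanSpace ℝ (Fin d) → ℝ := fun n x => η (((n : ℝ) + 1) • x)
  have hw : ∀ n, ContDiff ℝ ∞ (w n) := fun n => hη.comp (contDiff_const_smul _)
  have hprod : ∀ n, ContDiff ℝ ∞ fun x => φ x * w n x := fun n => hφ.mul (hw n)
  have hdefect : ∀ n, weakDefect u f r φ = weakDefect u f r fun x => φ x * w n x := by
    intro n
    have hψ : ContDiff ℝ ∞ fun x => φ x * (1 - w n x) := hφ.mul (contDiff_const.sub (hw n))
    have hzero : weakDefect u f r (fun x => φ x * (1 - w n x)) = 0 := by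
      refine hweak _ hψ hφc.mul_right fun x hx =>
        ⟨hφs (tsupport_mul_subset_left hx), ?_⟩
      rintro rfl
      refine notMem_tsupport_iff_eventuallyEq.2 ?_ hx
      have hcont : ContinuousAt (fun x : EuclideanSpace ℝ (Fin d) => ((n : ℝ) + 1) • x) 0 := by
        fun_prop
      have hev : ∀ᶠ x in 𝓝 (0 : EuclideanSpace ℝ (Fin d)),
          ((n : ℝ) + 1) • x ∈ Metric.closedBall (0 : EuclideanSpace ℝ (Fin d)) 1 :=
        hcont.eventually_mem (by simpa using Metric.closedBall_mem_nhds _ one_pos)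
      filter_upwards [hev] with x hx
      simp [w, η.one_of_mem_closedBall hx]
    have hsum := weakDefect_add hu hf hψ hφc.mul_right (hprod n) hφc.mul_right
    rw [hzero, zero_add] at hsum
    rw [← hsum]
    congr 1
    ext x
    ring
  have hlim_f : Tendsto (fun n => ∫ x in Metric.ball (0 : EuclideanSpace ℝ (Fin d)) r,
      f x * (φ x * w n x)) atTop (𝓝 0) := by
    simp only [← mul_assoc]
    refine tendsto_integral_mul_of_tendsto_zero hd (integrableOn_mul_test hf hφ hφc)
      (fun n => (hw n).continuous) (C := 1) (.of_forall fun n x _ => ?_) fun x hx => ?_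
    · rw [abs_of_nonneg η.nonneg]
      exact η.le_one
    · refine tendsto_const_nhds.congr' ?_
      have hx' : 0 < ‖x‖ := norm_pos_iff.2 hx
      filter_upwards [eventually_ge_atTop ⌈2 / ‖x‖⌉₊] with n hn
      refine (η.zero_of_le_dist ?_).symm
      have h1 : 2 / ‖x‖ ≤ n := Nat.ceil_le.1 hn
      rw [div_le_iff₀ hx'] at h1
      rw [dist_zero_right, norm_smul, Real.norm_of_nonneg (by positivity)]
      change (2 : ℝ) ≤ _
      linarith
  have hlim_u : Tendsto (fun n => ∫ x in Metric.ball (0 : EuclideanSpace ℝ (Fin d)) r,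
      u x * lap d (fun x => φ x * w n x) x) atTop (𝓝 0) := by
    obtain ⟨M, hM0, hM⟩ : ∃ M, 0 ≤ M ∧
        ∀ᵐ x ∂(volume.restrict (Metric.ball (0 : EuclideanSpace ℝ (Fin d)) r)), |u x| ≤ M :=
      exists_ae_abs_le hu
    obtain ⟨K, hK0, hK⟩ := exists_abs_le_mul_norm hφ hφc h0
    obtain ⟨P, hP0, hP⟩ := exists_bound_partialD hφ hφc
    obtain ⟨B, hB0, hB⟩ := exists_bound_partialD hη hηc
    obtain ⟨A, hA⟩ := hηc.lap.exists_bound_of_continuous hη.continuous_lap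
    obtain ⟨Q, hQ⟩ := hφc.lap.exists_bound_of_continuous hφ.continuous_lap
    have hA0 : 0 ≤ A := (norm_nonneg _).trans (hA 0)
    have hQ0 : 0 ≤ Q := (norm_nonneg _).trans (hQ 0)
    set D : ℝ := K * 2 * A + 2 * (d * (P * B)) + Q with hD
    have hD0 : 0 ≤ D := by positivity
    have hbound : ∀ (n : ℕ) (x : EuclideanSpace ℝ (Fin d)), |lap d (fun x => φ x * w n x) x| ≤
        (Metric.closedBall (0 : EuclideanSpace ℝ (Fin d)) (2 / ((n : ℝ) + 1))).indicator
          (fun _ => D * ((n : ℝ) + 1)) x := by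
      intro n x
      set c : ℝ := (n : ℝ) + 1 with hc
      have hc1 : 1 ≤ c := by simp [hc]
      have hc0 : 0 < c := by linarith
      have hexp : lap d (fun x => φ x * w n x) x = φ x * (c ^ 2 * lap d η (c • x)) +
          2 * ∑ i, partialD i φ x * (c * partialD i η (c • x)) + η (c • x) * lap d φ x := by
        rw [lap_mul hφ (hw n)]
        simp only [w, ← hc]
        rw [lap_comp_smul hη]
        simp only [partialD_comp_smul]
      by_cases hx : x ∈ Metric.closedBall (0 : EuclideanSpace ℝ (Fin d)) (2 / c)
      · rw [Set.indicator_of_mem hx, hexp]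
        rw [mem_closedBall_zero_iff, le_div_iff₀ hc0] at hx
        have e1 : |φ x * (c ^ 2 * lap d η (c • x))| ≤ K * 2 * A * c := by
          rw [abs_mul, abs_mul, abs_of_nonneg (sq_nonneg c)]
          calc |φ x| * (c ^ 2 * |lap d η (c • x)|) ≤ (K * ‖x‖) * (c ^ 2 * A) := by
                gcongr
                · exact hK x
                · exact hA _
            _ = K * (‖x‖ * c) * A * c := by ring
            _ ≤ _ := by gcongr
        have e2 : |2 * ∑ i, partialD i φ x * (c * partialD i η (c • x))| ≤
            2 * (d * (P * B)) * c := by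
          rw [abs_mul, abs_two]
          calc _ ≤ 2 * ∑ i : Fin d, P * (c * B) := by
                gcongr
                refine (Finset.abs_sum_le_sum_abs _ _).trans (Finset.sum_le_sum fun i _ => ?_)
                rw [abs_mul, abs_mul, abs_of_pos hc0]
                gcongr
                · exact hP i x
                · exact hB i _
            _ = _ := by simp; ring
        have e3 : |η (c • x) * lap d φ x| ≤ Q * c := by
          rw [abs_mul, abs_of_nonneg η.nonneg]
          calc _ ≤ 1 * Q := by
                gcongr
                · exact η.le_one
                · exact hQ x
            _ ≤ Q * c := by nlinarith
        calc _ ≤ K * 2 * A * c + 2 * (d * (P * B)) * c + Q * c :=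
              (abs_add_le _ _).trans (add_le_add ((abs_add_le _ _).trans (add_le_add e1 e2)) e3)
          _ = D * c := by rw [hD]; ring
      · have hcx : c • x ∉ tsupport η := by
          rw [mem_closedBall_zero_iff, le_div_iff₀ hc0] at hx
          rwa [hηs, mem_closedBall_zero_iff, norm_smul, Real.norm_of_nonneg hc0.le, mul_comm]
        have hp : ∀ i, partialD i η (c • x) = 0 := fun i =>
          image_eq_zero_of_notMem_tsupport fun h => hcx (tsupport_partialD_subset i _ h)
        rw [Set.indicator_of_notMem hx, hexp, lap_eq_zero_of_notMem_tsupport hcx,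
          image_eq_zero_of_notMem_tsupport hcx]
        simp [hp]
    set V : ℝ := volume.real (Metric.closedBall (0 : EuclideanSpace ℝ (Fin d)) 1)
    have hmain : ∀ n : ℕ, ‖∫ x in Metric.ball (0 : EuclideanSpace ℝ (Fin d)) r,
        u x * lap d (fun x => φ x * w n x) x‖ ≤ M * D * 2 ^ d * V * ((n : ℝ) + 1)⁻¹ := by
      intro n
      set c : ℝ := (n : ℝ) + 1 with hc
      have hc1 : 1 ≤ c := by simp [hc]
      have hc0 : 0 < c := by linarith
      let S := Metric.closedBall (0 : EuclideanSpace ℝ (Fin d)) (2 / c)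
      have hS : Integrable (S.indicator fun _ => M * (D * c)) :=
        (integrable_indicator_iff measurableSet_closedBall).2
          (integrableOn_const measure_closedBall_lt_top.ne)
      calc _ ≤ ∫ x in Metric.ball (0 : EuclideanSpace ℝ (Fin d)) r,
              S.indicator (fun _ => M * (D * c)) x := by
            refine norm_integral_le_of_norm_le hS.restrict ?_
            filter_upwards [hM] with x hx
            rw [Real.norm_eq_abs, abs_mul, Set.indicator_const_mul]
            exact mul_le_mul hx (hbound n x) (abs_nonneg _) hM0
        _ ≤ ∫ x, S.indicator (fun _ => M * (D * c)) x :=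
            setIntegral_le_integral hS (.of_forall fun x =>
              Set.indicator_nonneg (fun _ _ => by positivity) x)
        _ = (2 / c) ^ d * V * (M * (D * c)) := by
            rw [integral_indicator_const _ measurableSet_closedBall, smul_eq_mul,
              Measure.addHaar_real_closedBall' _ _ (by positivity)]
            simp [V]
        _ ≤ _ := by
            have hpow : c⁻¹ ^ d ≤ c⁻¹ ^ 2 :=
              pow_le_pow_of_le_one (by positivity) (inv_le_one_of_one_le₀ hc1) hd
            calc _ = M * D * 2 ^ d * V * (c⁻¹ ^ d * c) := by rw [div_eq_mul_inv, mul_pow]; ring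
              _ ≤ M * D * 2 ^ d * V * (c⁻¹ ^ 2 * c) := by gcongr
              _ = _ := by field_simp
    refine squeeze_zero_norm hmain ?_
    simpa [one_div] using (tendsto_one_div_add_atTop_nhds_zero_nat (𝕜 := ℝ)).const_mul
      (M * D * 2 ^ d * V)
  have hlim : Tendsto (fun n => weakDefect u f r fun x => φ x * w n x) atTop (𝓝 0) := by
    simpa [weakDefect] using hlim_u.sub hlim_f
  exact tendsto_nhds_unique (tendsto_const_nhds.congr hdefect) hlim

/-- The defects of the regularized logarithms, cut off by a fixed test function, tend to zero. -/
theorem tendsto_weakDefect_mul_regLog (hd : 2 ≤ d)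
    (hu : MemLp u ⊤ (volume.restrict (Metric.ball (0 : EuclideanSpace ℝ (Fin d)) r)))
    (hf : IntegrableOn f (Metric.ball 0 r))
    {ψ : EuclideanSpace ℝ (Fin d) → ℝ} (hψ : ContDiff ℝ ∞ ψ) (hψc : HasCompactSupport ψ)
    (hψs : tsupport ψ ⊆ Metric.ball 0 r) (hψ0 : ∀ x, 0 ≤ ψ x) (hψd : fderiv ℝ ψ 0 = 0) :
    Tendsto (fun n => weakDefect u f r fun x => ψ x * regLog d n x) atTop (𝓝 0) := by
  set Ω := Metric.ball (0 : EuclideanSpace ℝ (Fin d)) r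
  have hv : ∀ n, ContDiff ℝ ∞ (regLog d n) := contDiff_regLog d
  have hvb : ∀ᶠ n in atTop, ∀ x ∈ Ω, |regLog d n x| ≤ 1 + r ^ 2 := by
    filter_upwards [eventually_ne_atTop 0] with n hn x hx
    exact abs_regLog_le hn (mem_ball_zero_iff.1 hx).le
  have hlim_f : Tendsto (fun n => ∫ x in Ω, f x * (ψ x * regLog d n x)) atTop (𝓝 0) := by
    simp only [← mul_assoc]
    exact tendsto_integral_mul_of_tendsto_zero hd (integrableOn_mul_test hf hψ hψc)
      (fun n => (hv n).continuous) hvb fun x hx => tendsto_regLog hx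
  have hlap : Integrable (lap d ψ) :=
    hψ.continuous_lap.integrable_of_hasCompactSupport hψc.lap
  have hlim_lap : Tendsto (fun n => ∫ x in Ω, |lap d ψ x| * |regLog d n x|) atTop (𝓝 0) :=
    tendsto_integral_mul_of_tendsto_zero hd hlap.abs.integrableOn
      (fun n => (hv n).continuous.abs) (by simpa only [abs_abs] using hvb)
      fun x hx => by simpa using (tendsto_regLog hx).abs
  have hlim_u : Tendsto (fun n => ∫ x in Ω, u x * lap d (fun x => ψ x * regLog d n x) x)
      atTop (𝓝 0) := by
    obtain ⟨M, hM0, hM⟩ := exists_ae_abs_le hu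
    have hKi : ∀ i, ∃ K, 0 ≤ K ∧ ∀ x, |partialD i ψ x| ≤ K * ‖x‖ := fun i =>
      exists_abs_le_mul_norm (hψ.partialD i) (hψc.partialD i) (by simp [partialD, hψd])
    choose K hK0 hK using hKi
    have hbound : ∀ n, ‖∫ x in Ω, u x * lap d (fun x => ψ x * regLog d n x) x‖ ≤
        M * (2 * ∫ x in Ω, |lap d ψ x| * |regLog d n x|) +
          M * (2 * ∑ i, K i * 2) * volume.real Ω * (n : ℝ)⁻¹ := by
      intro n
      have hint1 : Integrable fun x => ψ x * lap d (regLog d n) x :=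
        (hψ.continuous.mul (hv n).continuous_lap).integrable_of_hasCompactSupport hψc.mul_right
      have hint2 : Integrable fun x => lap d ψ x * regLog d n x :=
        (hψ.continuous_lap.mul (hv n).continuous).integrable_of_hasCompactSupport hψc.lap.mul_right
      have hint2' : Integrable fun x => |lap d ψ x| * |regLog d n x| := by
        simpa only [abs_mul] using hint2.abs
      have hconst : IntegrableOn (fun _ => 2 * ∑ i, K i * (2 * (n : ℝ)⁻¹)) Ω :=
        integrableOn_const measure_ball_lt_top.ne
      have hparts : ∫ x in Ω, ψ x * lap d (regLog d n) x ≤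
          ∫ x in Ω, |lap d ψ x| * |regLog d n x| := by
        have hout : ∀ x ∉ Ω, x ∉ tsupport ψ := fun x hx h => hx (hψs h)
        rw [setIntegral_eq_integral_of_forall_compl_eq_zero fun x hx => by
            rw [image_eq_zero_of_notMem_tsupport (hout x hx), zero_mul],
          integral_mul_lap_comm hψ hψc (hv n),
          ← setIntegral_eq_integral_of_forall_compl_eq_zero (s := Ω) fun x hx => by
            rw [lap_eq_zero_of_notMem_tsupport (hout x hx), zero_mul]]
        refine integral_mono hint2.restrict hint2'.restrict fun x => ?_
        exact (le_abs_self _).trans (abs_mul _ _).le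
      have hpt : ∀ x, |lap d (fun x => ψ x * regLog d n x) x| ≤ ψ x * lap d (regLog d n) x +
          2 * ∑ i, K i * (2 * (n : ℝ)⁻¹) + |lap d ψ x| * |regLog d n x| := by
        intro x
        rw [lap_mul hψ (hv n)]
        refine (abs_add_le _ _).trans (add_le_add ((abs_add_le _ _).trans (add_le_add ?_ ?_)) ?_)
        · exact (abs_of_nonneg (mul_nonneg (hψ0 x) (lap_regLog_nonneg hd n x))).le
        · rw [abs_mul, abs_two]
          gcongr
          refine (Finset.abs_sum_le_sum_abs _ _).trans (Finset.sum_le_sum fun i _ => ?_)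
          rw [abs_mul]
          calc _ ≤ K i * ‖x‖ * |partialD i (regLog d n) x| := by gcongr; exact hK i x
            _ = K i * (‖x‖ * |partialD i (regLog d n) x|) := by ring
            _ ≤ _ := mul_le_mul_of_nonneg_left (norm_mul_abs_partialD_regLog_le n i x) (hK0 i)
        · rw [abs_mul, mul_comm]
      calc _ ≤ ∫ x in Ω, M * (ψ x * lap d (regLog d n) x +
              2 * ∑ i, K i * (2 * (n : ℝ)⁻¹) + |lap d ψ x| * |regLog d n x|) := by
            refine norm_integral_le_of_norm_le
              (((hint1.restrict.add hconst).add hint2'.restrict).const_mul M) ?_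
            filter_upwards [hM] with x hx
            rw [Real.norm_eq_abs, abs_mul]
            exact mul_le_mul hx (hpt x) (abs_nonneg _) hM0
        _ = M * ((∫ x in Ω, ψ x * lap d (regLog d n) x) +
              volume.real Ω * (2 * ∑ i, K i * (2 * (n : ℝ)⁻¹)) +
              ∫ x in Ω, |lap d ψ x| * |regLog d n x|) := by
            rw [integral_const_mul, integral_add (hint1.restrict.fun_add hconst) hint2'.restrict,
              integral_add hint1.restrict hconst, setIntegral_const, smul_eq_mul]
        _ ≤ M * ((∫ x in Ω, |lap d ψ x| * |regLog d n x|) +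
              volume.real Ω * (2 * ∑ i, K i * (2 * (n : ℝ)⁻¹)) +
              ∫ x in Ω, |lap d ψ x| * |regLog d n x|) := by gcongr
        _ = _ := by
            simp only [← mul_assoc, ← Finset.sum_mul]
            ring
    refine squeeze_zero_norm hbound ?_
    simpa using ((hlim_lap.const_mul 2).const_mul M).add
      ((tendsto_inv_atTop_nhds_zero_nat (𝕜 := ℝ)).const_mul
        (M * (2 * ∑ i, K i * 2) * volume.real Ω))
  simpa [weakDefect] using hlim_u.sub hlim_f

/-- The origin is removable for the weak equation `Δu = f` with `u` bounded and `f` integrable. -/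
theorem weakDefect_eq_zero (hd : 2 ≤ d) (hr : 0 < r)
    (hu : MemLp u ⊤ (volume.restrict (Metric.ball (0 : EuclideanSpace ℝ (Fin d)) r)))
    (hf : IntegrableOn f (Metric.ball 0 r))
    (hweak : ∀ φ : EuclideanSpace ℝ (Fin d) → ℝ, ContDiff ℝ ∞ φ → HasCompactSupport φ →
      tsupport φ ⊆ Metric.ball 0 r \ {0} → weakDefect u f r φ = 0)
    {φ : EuclideanSpace ℝ (Fin d) → ℝ} (hφ : ContDiff ℝ ∞ φ) (hφc : HasCompactSupport φ)
    (hφs : tsupport φ ⊆ Metric.ball 0 r) : weakDefect u f r φ = 0 := by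
  let ψ : ContDiffBump (0 : EuclideanSpace ℝ (Fin d)) :=
    ⟨r / 4, r / 2, by positivity, by linarith⟩
  have hψ : ContDiff ℝ ∞ ψ := ψ.contDiff
  have hψs : tsupport ψ ⊆ Metric.ball 0 r := by
    rw [ψ.tsupport_eq]
    exact Metric.closedBall_subset_ball (half_lt_self hr)
  have hψd : fderiv ℝ ψ 0 = 0 := by
    rw [ψ.eventuallyEq_one.fderiv_eq]
    exact fderiv_const_apply 1
  have hlim := (tendsto_weakDefect_mul_regLog hd hu hf hψ ψ.hasCompactSupport hψs
    (fun _ => ψ.nonneg) hψd).const_mul (-φ 0)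
  rw [mul_zero] at hlim
  refine tendsto_nhds_unique (tendsto_const_nhds.congr' ?_) hlim
  filter_upwards [eventually_ne_atTop 0] with n hn
  have hψn : ContDiff ℝ ∞ fun x => ψ x * regLog d n x := hψ.mul (contDiff_regLog d n)
  have hψnc : HasCompactSupport fun x => ψ x * regLog d n x := ψ.hasCompactSupport.mul_right
  have hcn : ContDiff ℝ ∞ fun x => φ 0 * (ψ x * regLog d n x) := contDiff_const.mul hψn
  have hcnc : HasCompactSupport fun x => φ 0 * (ψ x * regLog d n x) := hψnc.mul_left
  have hzero : weakDefect u f r (fun x => φ x + φ 0 * (ψ x * regLog d n x)) = 0 := by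
    refine weakDefect_eq_zero_of_apply_zero hd hu hf hweak (hφ.add hcn) (hφc.add hcnc) ?_ ?_
    · refine (tsupport_add _ _).trans (Set.union_subset hφs ?_)
      exact tsupport_mul_subset_right.trans (tsupport_mul_subset_left.trans hψs)
    · rw [regLog_zero hn, ψ.eventuallyEq_one.eq_of_nhds]
      simp
  rw [weakDefect_add hu hf hφ hφc hcn hcnc, weakDefect_const_mul hψn] at hzero
  linarith

end weakDefect

end

theorem stmt9 (d : ℕ) (hd : 2 ≤ d) (r₀ : ℝ) (hr₀ : 0 < r₀) (p : ℝ) (hp : (d : ℝ) / 2 < p)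
    (u f : EuclideanSpace ℝ (Fin d) → ℝ)
    (hu : MemLp u ⊤ (volume.restrict (Metric.ball (0 : EuclideanSpace ℝ (Fin d)) r₀)))
    (hf : MemLp f (ENNReal.ofReal p)
      (volume.restrict (Metric.ball (0 : EuclideanSpace ℝ (Fin d)) r₀)))
    (hweak : ∀ φ : EuclideanSpace ℝ (Fin d) → ℝ,
      (∀ n : ℕ, ContDiff ℝ n φ) → HasCompactSupport φ →
      tsupport φ ⊆ Metric.ball (0 : EuclideanSpace ℝ (Fin d)) r₀ \ {0} →
      ∫ x in Metric.ball (0 : EuclideanSpace ℝ (Fin d)) r₀, u x * lap d φ x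
        = ∫ x in Metric.ball (0 : EuclideanSpace ℝ (Fin d)) r₀, f x * φ x) :
    ∀ φ : EuclideanSpace ℝ (Fin d) → ℝ,
      (∀ n : ℕ, ContDiff ℝ n φ) → HasCompactSupport φ →
      tsupport φ ⊆ Metric.ball (0 : EuclideanSpace ℝ (Fin d)) r₀ →
      ∫ x in Metric.ball (0 : EuclideanSpace ℝ (Fin d)) r₀, u x * lap d φ x
        = ∫ x in Metric.ball (0 : EuclideanSpace ℝ (Fin d)) r₀, f x * φ x := by
  intro φ hφ hφc hφs
  have hp1 : 1 ≤ ENNReal.ofReal p := by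
    have hd' : (2 : ℝ) ≤ d := by exact_mod_cast hd
    rw [ENNReal.one_le_ofReal]
    linarith
  have : IsFiniteMeasure (volume.restrict (Metric.ball (0 : EuclideanSpace ℝ (Fin d)) r₀)) :=
    isFiniteMeasure_restrict.2 measure_ball_lt_top.ne
  refine sub_eq_zero.1 (weakDefect_eq_zero hd hr₀ hu (hf.integrable hp1) ?_
    (contDiff_infty.2 hφ) hφc hφs)
  exact fun χ hχ hχc hχs => sub_eq_zero.2 (hweak χ (contDiff_infty.1 hχ) hχc hχs)
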